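/- The number of integral n×n×n stochastic semi-magic cubes (i.e., arrays of nonnegative integers in which every axis-parallel line sums to 1) equals the number of n×n Latin squares; in particular, the number of vertices of the polytope of n×n×n stochastic semi-magic cubes is at least (n!)^{2n}/n^{n²}. -/

import Mathlib

/-- An integral n×n×n stochastic semi-magic cube: nonnegative integer entries,
every axis-parallel line sums to 1. -/
def IsStochCube (n : ℕ) (A : Fin n → Fin n → Fin n → ℕ) : Prop :=
  (∀ i j, ∑ k, A i j k = 1) ∧ (∀ i k, ∑ j, A i j k = 1) ∧ (∀ j k, ∑ i, A i j k = 1)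

/-- An n×n Latin square: each symbol occurs exactly once in each row and column. -/
def IsLatin (n : ℕ) (L : Fin n → Fin n → Fin n) : Prop :=
  (∀ i, Function.Bijective (L i)) ∧ (∀ j, Function.Bijective fun i => L i j)

open MvPolynomial in
/-- A complex polynomial is `HalfPlaneStable` if it does not vanish at points whose coordinates
have nonnegative real parts, not all zero. -/
def HalfPlaneStable {n : ℕ} (p : MvPolynomial (Fin n) ℂ) : Prop :=
  ∀ z : Fin n → ℂ, (∀ i, 0 ≤ (z i).re) → (∃ i, 0 < (z i).re) → eval z p ≠ 0

/-- If all roots of a complex polynomial of degree `d + 1` with `d ≥ 1` are negative reals and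
`D * t ≤ ‖f t‖` for all `t > 0`, then `‖f' 0‖ ≥ D * (d / (d + 1)) ^ d`. -/
theorem Polynomial.mul_pow_le_norm_coeff_one {f : Polynomial ℂ} {d : ℕ} (hd : d ≠ 0)
    (hf : f.natDegree = d + 1) (hroots : ∀ w ∈ f.roots, ∃ r : ℝ, 0 < r ∧ w = -(r : ℂ))
    {D : ℝ} (hD : ∀ t : ℝ, 0 < t → D * t ≤ ‖f.eval (t : ℂ)‖) :
    D * ((d : ℝ) / (d + 1)) ^ d ≤ ‖f.coeff 1‖ := by
  have hd0 : (0 : ℝ) < d := by positivity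
  have hsplit : f.Splits := IsAlgClosed.splits f
  have hcard : Multiset.card f.roots = d + 1 := by rw [← hf, hsplit.natDegree_eq_card_roots]
  have hf0 : f ≠ 0 := by rintro rfl; simp at hf
  have heval0 : f.eval 0 ≠ 0 := fun h => by
    obtain ⟨r, hr, h0⟩ := hroots 0 ((Polynomial.mem_roots hf0).2 h)
    have : (r : ℂ) = 0 := by simpa using h0.symm
    exact hr.ne' (by exact_mod_cast this)
  set S : ℝ := (f.roots.map fun w => ‖w‖⁻¹).sum with hS
  have hcoeff : ‖f.coeff 1‖ = ‖f.eval 0‖ * S := by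
    have h1 : f.derivative.eval 0 = f.coeff 1 := by
      rw [← Polynomial.coeff_zero_eq_eval_zero, Polynomial.coeff_derivative]; simp
    have h2 := hsplit.eval_derivative_div_eval_of_ne_zero heval0
    have h3 : (f.roots.map fun w => 1 / (0 - w)).sum = (S : ℂ) := by
      rw [hS, ← Complex.ofRealHom_eq_coe, map_multiset_sum, Multiset.map_map]
      congr 1
      refine Multiset.map_congr rfl fun w hw => ?_
      obtain ⟨r, hr, rfl⟩ := hroots w hw
      simp [abs_of_pos hr]
    have hS0 : 0 ≤ S := Multiset.sum_nonneg fun x hx => by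
      obtain ⟨w, -, rfl⟩ := Multiset.mem_map.1 hx
      positivity
    rw [h3, h1, div_eq_iff heval0] at h2
    rw [h2, norm_mul, Complex.norm_real, Real.norm_of_nonneg hS0, mul_comm]
  have hSpos : 0 < S := by
    obtain ⟨w, hw⟩ := Multiset.card_pos_iff_exists_mem.1 (by omega : 0 < Multiset.card f.roots)
    obtain ⟨r, hr, rfl⟩ := hroots w hw
    have : ‖-(r : ℂ)‖⁻¹ ≤ S := Multiset.single_le_sum (fun x hx => by
      obtain ⟨w, -, rfl⟩ := Multiset.mem_map.1 hx
      positivity) _ (Multiset.mem_map_of_mem (fun w : ℂ => ‖w‖⁻¹) hw)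
    refine lt_of_lt_of_le ?_ this
    simp [hr.ne']
  have hnorm (t : ℝ) (ht : 0 < t) :
      ‖f.eval (t : ℂ)‖ = ‖f.eval 0‖ * (f.roots.map fun w => 1 + t * ‖w‖⁻¹).prod := by
    rw [hsplit.eval_eq_prod_roots, hsplit.eval_eq_prod_roots, norm_mul, norm_mul, mul_assoc]
    congr 1
    have hm (m : Multiset ℂ) : ‖m.prod‖ = (m.map fun w => ‖w‖).prod := map_multiset_prod normHom m
    rw [hm, hm, Multiset.map_map, Multiset.map_map, ← Multiset.prod_map_mul]
    congr 1
    refine Multiset.map_congr rfl fun w hw => ?_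
    obtain ⟨r, hr, rfl⟩ := hroots w hw
    have : (t : ℂ) + r = ((t + r : ℝ) : ℂ) := by push_cast; rfl
    simp only [Function.comp, sub_neg_eq_add, zero_add, norm_neg, this, Complex.norm_real,
      Real.norm_of_nonneg hr.le, Real.norm_of_nonneg (add_pos ht hr).le]
    field_simp
    ring
  have hprod (t M : ℝ) (ht : 0 < t) (hM : 0 < M) :
      (f.roots.map fun w => 1 + t * ‖w‖⁻¹).prod ≤
        M ^ (d + 1) * Real.exp ((d + 1 + t * S) / M - (d + 1)) := by
    calc (f.roots.map fun w => 1 + t * ‖w‖⁻¹).prod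
        ≤ (f.roots.map fun w => M * Real.exp ((1 + t * ‖w‖⁻¹) / M - 1)).prod := by
          refine Multiset.prod_map_le_prod_map₀ _ _ (fun w _ => by positivity) fun w _ => ?_
          have := Real.add_one_le_exp ((1 + t * ‖w‖⁻¹) / M - 1)
          rw [sub_add_cancel, div_le_iff₀ hM] at this
          linarith
      _ = M ^ (d + 1) * Real.exp ((d + 1 + t * S) / M - (d + 1)) := by
          rw [Multiset.prod_map_mul, Multiset.map_const', Multiset.prod_replicate, hcard,
            ← Function.comp_def Real.exp, ← Multiset.map_map, ← Real.exp_multiset_sum]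
          congr 2
          rw [Multiset.sum_map_sub, Multiset.sum_map_div, Multiset.sum_map_add,
            Multiset.sum_map_mul_left]
          simp [hcard, hS, add_comm]
  set t : ℝ := (d + 1) / (S * d) with ht
  have htpos : 0 < t := by positivity
  have key := (hD t htpos).trans_eq (hnorm t htpos)
  have hp := hprod t ((d + 1) / d) htpos (by positivity)
  have h0 : ((d + 1 + t * S) / ((d + 1) / d) - (d + 1) : ℝ) = 0 := by
    rw [ht]; field_simp; ring
  rw [h0, Real.exp_zero, mul_one] at hp
  have h1 : D * t ≤ ‖f.eval 0‖ * (((d : ℝ) + 1) / d) ^ (d + 1) :=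
    key.trans (mul_le_mul_of_nonneg_left hp (norm_nonneg _))
  rw [hcoeff]
  have h2 : D ≤ ‖f.eval 0‖ * S * (((d : ℝ) + 1) / d) ^ d := by
    rw [← le_div_iff₀ htpos] at h1
    refine h1.trans_eq ?_
    rw [ht, pow_succ]
    field_simp
  calc D * ((d : ℝ) / (d + 1)) ^ d
      ≤ (‖f.eval 0‖ * S * (((d : ℝ) + 1) / d) ^ d) * ((d : ℝ) / (d + 1)) ^ d := by gcongr
    _ = ‖f.eval 0‖ * S := by
      rw [mul_assoc, ← mul_pow, div_mul_div_cancel₀ hd0.ne', div_self (by positivity), one_pow,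
        mul_one]

namespace MvPolynomial

theorem IsHomogeneous.eval_smul {σ R : Type*} [CommSemiring R] [Fintype σ]
    {p : MvPolynomial σ R} {k : ℕ} (hp : p.IsHomogeneous k) (c : R) (z : σ → R) :
    eval (c • z) p = c ^ k * eval z p := by
  rw [eval_eq', eval_eq', Finset.mul_sum]
  refine Finset.sum_congr rfl fun m hm => ?_
  have hk : ∑ i, m i = k := by
    rw [← hp (mem_support_iff.1 hm), Finsupp.weight_apply, Finsupp.sum_fintype _ _ (by simp)]
    simp
  simp only [Pi.smul_apply, smul_eq_mul, mul_pow, Finset.prod_mul_distrib,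
    Finset.prod_pow_eq_pow_sum, hk]
  ring

variable {n k : ℕ} {p : MvPolynomial (Fin (n + 1)) ℂ}

theorem eval_cons_zero_ne_zero (h : HalfPlaneStable p) :
    eval (Fin.cons 1 0 : Fin (n + 1) → ℂ) p ≠ 0 :=
  h _ (fun i => by cases i using Fin.cases <;> simp) ⟨0, by simp⟩

theorem natDegree_map_eval_finSuccEquiv (hp : p.IsHomogeneous k) (h : HalfPlaneStable p)
    (y : Fin n → ℂ) : (Polynomial.map (eval y) (finSuccEquiv ℂ n p)).natDegree = k := by
  refine le_antisymm ?_ (Polynomial.le_natDegree_of_ne_zero ?_)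
  · refine Polynomial.natDegree_map_le.trans ?_
    rw [natDegree_finSuccEquiv]
    exact (degreeOf_le_totalDegree p 0).trans hp.totalDegree_le
  · have hc : ((finSuccEquiv ℂ n p).coeff k).IsHomogeneous 0 :=
      hp.finSuccEquiv_coeff_isHomogeneous k 0 (by simp)
    have h0 : Polynomial.map (eval 0) (finSuccEquiv ℂ n p) =
        Polynomial.C (eval (Fin.cons 1 0 : Fin (n + 1) → ℂ) p) * Polynomial.X ^ k := by
      refine Polynomial.funext fun t => ?_
      rw [← eval_eq_eval_mv_eval']
      have : (Fin.cons t 0 : Fin (n + 1) → ℂ) = t • (Fin.cons 1 0 : Fin (n + 1) → ℂ) := by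
        funext i; cases i using Fin.cases <;> simp
      rw [this, hp.eval_smul]
      simp [mul_comm (t ^ k)]
    have h1 := congrArg (fun f => Polynomial.coeff f k) h0
    simp only [Polynomial.coeff_map, Polynomial.coeff_C_mul, Polynomial.coeff_X_pow_self,
      mul_one] at h1
    rw [← totalDegree_zero_iff_isHomogeneous, totalDegree_eq_zero_iff_eq_C] at hc
    rw [hc, eval_C] at h1
    rw [Polynomial.coeff_map, hc, eval_C, h1]
    exact eval_cons_zero_ne_zero h

theorem re_neg_of_eval_map_finSuccEquiv_eq_zero (h : HalfPlaneStable p) {y : Fin n → ℂ}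
    (hy : ∀ i, 0 ≤ (y i).re) (hy' : ∃ i, 0 < (y i).re) {w : ℂ}
    (hw : (Polynomial.map (eval y) (finSuccEquiv ℂ n p)).eval w = 0) : w.re < 0 := by
  by_contra! hre
  rw [← eval_eq_eval_mv_eval'] at hw
  obtain ⟨i, hi⟩ := hy'
  exact h _ (fun j => by cases j using Fin.cases <;> simp [hre, hy]) ⟨i.succ, by simpa⟩ hw

theorem exists_eq_neg_of_eval_map_finSuccEquiv_eq_zero (hp : p.IsHomogeneous k)
    (h : HalfPlaneStable p) (hn : n ≠ 0) {x : Fin n → ℝ} (hx : ∀ i, 0 < x i) {w : ℂ}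
    (hw : (Polynomial.map (eval fun i => (x i : ℂ)) (finSuccEquiv ℂ n p)).eval w = 0) :
    ∃ r : ℝ, 0 < r ∧ w = -(r : ℂ) := by
  have hpos : 0 < n := Nat.pos_of_ne_zero hn
  have hre := re_neg_of_eval_map_finSuccEquiv_eq_zero h (fun i => by simpa using (hx i).le)
    ⟨⟨0, hpos⟩, by simpa using hx _⟩ hw
  suffices him : w.im = 0 by
    exact ⟨-w.re, by linarith, Complex.ext (by simp) (by simp [him])⟩
  by_contra him
  rw [← eval_eq_eval_mv_eval'] at hw
  refine h ((1 + (w.re / w.im : ℝ) * Complex.I) • Fin.cons w fun i => (x i : ℂ)) (fun i => ?_)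
    ⟨Fin.succ ⟨0, hpos⟩, ?_⟩ (by rw [hp.eval_smul, hw, mul_zero])
  · cases i using Fin.cases with
    | zero => simp [-Complex.ofReal_div, him]
    | succ i => simpa [-Complex.ofReal_div] using (hx i).le
  · simpa [-Complex.ofReal_div, -Fin.succ_mk] using hx _

theorem _root_.HalfPlaneStable.coeff_one_finSuccEquiv (h : HalfPlaneStable p)
    (hp : p.IsHomogeneous (k + 1)) : HalfPlaneStable ((finSuccEquiv ℂ n p).coeff 1) := by
  intro y hy hy' h0
  set f := Polynomial.map (eval y) (finSuccEquiv ℂ n p) with hf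
  have hdeg : f.natDegree = k + 1 := natDegree_map_eval_finSuccEquiv hp h y
  have hder : f.derivative.eval 0 = 0 := by
    rw [← Polynomial.coeff_zero_eq_eval_zero, Polynomial.coeff_derivative, hf,
      Polynomial.coeff_map, zero_add, h0, zero_mul]
  have hne : f.derivative ≠ 0 := fun h => by
    have := Polynomial.derivative_eq_zero.1 h
    omega
  have hmem : (0 : ℂ) ∈ f.derivative.rootSet ℂ := by
    rw [Polynomial.mem_rootSet]
    exact ⟨hne, by simpa using hder⟩
  have hsub : convexHull ℝ (f.rootSet ℂ) ⊆ {w : ℂ | w.re < 0} := by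
    refine convexHull_min (fun w hw => ?_) (convex_halfSpace_re_lt 0)
    rw [Polynomial.mem_rootSet] at hw
    exact re_neg_of_eval_map_finSuccEquiv_eq_zero h hy hy' (by simpa using hw.2)
  have := hsub (f.rootSet_derivative_subset_convexHull_rootSet
    (Polynomial.natDegree_pos_iff_degree_pos.1 (by omega)) hmem)
  simp at this

/-- Gurvits' capacity inequality. -/
theorem mul_factorial_div_pow_le_norm_coeff (n : ℕ) (p : MvPolynomial (Fin n) ℂ)
    (hp : p.IsHomogeneous n) (h : HalfPlaneStable p) (D : ℝ)
    (hD : ∀ x : Fin n → ℝ, (∀ i, 0 < x i) → D * ∏ i, x i ≤ ‖eval (fun i => (x i : ℂ)) p‖) :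
    D * (n.factorial / (n : ℝ) ^ n) ≤ ‖coeff (Finsupp.equivFunOnFinite.symm fun _ => 1) p‖ := by
  induction n generalizing D with
  | zero =>
    have h1 := hD 0 (fun i => i.elim0)
    have h2 : p = C (coeff 0 p) := by
      rw [← totalDegree_eq_zero_iff_eq_C]; simpa using hp.totalDegree_le
    have h3 : (Finsupp.equivFunOnFinite.symm fun _ => 1 : Fin 0 →₀ ℕ) = 0 := Subsingleton.elim _ _
    rw [h2, eval_C] at h1
    simpa [h3] using h1
  | succ n ih =>
    have hones : (Finsupp.equivFunOnFinite.symm fun _ => 1 : Fin (n + 1) →₀ ℕ) =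
        (Finsupp.equivFunOnFinite.symm fun _ => 1 : Fin n →₀ ℕ).cons 1 := by
      ext i; cases i using Fin.cases <;> simp
    rw [hones, ← finSuccEquiv_coeff_coeff]
    refine le_trans (le_of_eq ?_) (ih _ (hp.finSuccEquiv_coeff_isHomogeneous 1 n (add_comm _ _))
      (h.coeff_one_finSuccEquiv hp) (D * ((n : ℝ) / (n + 1)) ^ n) fun x hx => ?_)
    · rcases eq_or_ne n 0 with rfl | hn
      · simp
      · have : (n : ℝ) ≠ 0 := by exact_mod_cast hn
        rw [Nat.factorial_succ]
        push_cast
        rw [div_pow]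
        field_simp
        ring
    · set f := Polynomial.map (eval fun i => (x i : ℂ)) (finSuccEquiv ℂ n p) with hf
      have hdeg : f.natDegree = n + 1 := natDegree_map_eval_finSuccEquiv hp h _
      have hDf (t : ℝ) (ht : 0 < t) : D * (∏ i, x i) * t ≤ ‖f.eval (t : ℂ)‖ := by
        have := hD (Fin.cons t x) (fun i => by cases i using Fin.cases <;> simp [ht, hx])
        have hc : (fun i => ((Fin.cons t x : Fin (n + 1) → ℝ) i : ℂ)) =
            Fin.cons (t : ℂ) fun i => (x i : ℂ) := by
          funext i; cases i using Fin.cases <;> simp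
        rw [Fin.prod_univ_succ, hc, eval_eq_eval_mv_eval'] at this
        simp only [Fin.cons_zero, Fin.cons_succ] at this
        linarith
      have hcoeff : eval (fun i => (x i : ℂ)) ((finSuccEquiv ℂ n p).coeff 1) = f.coeff 1 := by
        rw [hf, Polynomial.coeff_map]
      rw [hcoeff]
      rcases eq_or_ne n 0 with rfl | hn
      · have hc0 : f.coeff 0 = 0 := by
          rw [Polynomial.coeff_zero_eq_eval_zero, hf, ← eval_eq_eval_mv_eval']
          have : (Fin.cons 0 fun i => (x i : ℂ) : Fin (0 + 1) → ℂ) =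
              (0 : ℂ) • (Fin.cons 0 fun i => (x i : ℂ) : Fin (0 + 1) → ℂ) := by
            funext i; fin_cases i; simp
          rw [this, hp.eval_smul]; simp
        have := hDf 1 one_pos
        rw [Polynomial.eval_eq_sum_range, hdeg, Finset.sum_range_succ] at this
        simpa [hc0] using this
      · have := Polynomial.mul_pow_le_norm_coeff_one hn hdeg (fun w hw =>
          exists_eq_neg_of_eval_map_finSuccEquiv_eq_zero hp h hn hx
            (Polynomial.isRoot_of_mem_roots hw)) hDf
        linarith

end MvPolynomial

namespace Matrix

open MvPolynomial

theorem coeff_prod_sum_C_mul_X {ι R : Type*} [Fintype ι] [DecidableEq ι] [CommSemiring R]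
    (M : Matrix ι ι R) :
    coeff (Finsupp.equivFunOnFinite.symm fun _ => 1) (∏ j, ∑ i, C (M i j) * X i) =
      M.permanent := by
  have hterm (f : ι → ι) : ∏ j, (C (M (f j) j) * X (f j) : MvPolynomial ι R) =
      monomial (∑ j, Finsupp.single (f j) 1) (∏ j, M (f j) j) := by
    rw [Finset.prod_mul_distrib, ← map_prod, ← mul_one (∏ j, M (f j) j), ← C_mul_monomial,
      mul_one, monomial_sum_one]
    rfl
  rw [Finset.prod_univ_sum, Fintype.piFinset_univ, coeff_sum, permanent]
  symm
  refine Fintype.sum_of_injective (fun σ : Equiv.Perm ι => (σ : ι → ι)) DFunLike.coe_injective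
    _ _ (fun f hf => ?_) fun σ => ?_
  · rw [hterm, coeff_monomial, if_neg]
    refine fun h => hf ⟨Equiv.ofBijective f ?_, rfl⟩
    refine Finite.surjective_iff_bijective.1 fun i => ?_
    by_contra! hi
    have := DFunLike.congr_fun h i
    simp [hi] at this
  · rw [hterm, coeff_monomial, if_pos]
    ext i
    simp [Finsupp.single_apply, ← Equiv.eq_symm_apply]

variable {n : ℕ}

theorem factorial_div_pow_le_permanent_of_pos {A B : Matrix (Fin n) (Fin n) ℝ}
    (hA : A ∈ doublyStochastic ℝ (Fin n)) (hAB : ∀ i j, A i j ≤ B i j) (hB : ∀ i j, 0 < B i j) :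
    n.factorial / (n : ℝ) ^ n ≤ B.permanent := by
  rw [mem_doublyStochastic_iff_sum] at hA
  obtain ⟨hA0, hrow, hcol⟩ := hA
  set p : MvPolynomial (Fin n) ℂ := ∏ j, ∑ i, C (B i j : ℂ) * X i with hp
  have heval (z : Fin n → ℂ) : eval z p = ∏ j, ∑ i, (B i j : ℂ) * z i := by
    simp [hp, map_prod]
  have hhom : p.IsHomogeneous n := by
    have := IsHomogeneous.prod Finset.univ (fun j => ∑ i, C (B i j : ℂ) * X i) (fun _ => 1)
      fun j _ => IsHomogeneous.sum _ _ 1 fun i _ => isHomogeneous_C_mul_X _ i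
    simpa using this
  have hstable : HalfPlaneStable p := by
    rintro z hz ⟨i, hi⟩ h
    rw [heval, Finset.prod_eq_zero_iff] at h
    obtain ⟨j, -, h⟩ := h
    have hre := congrArg Complex.re h
    simp only [Complex.re_sum, Complex.re_ofReal_mul, Complex.zero_re] at hre
    refine (Finset.sum_pos' (fun i _ => mul_nonneg (hB i j).le (hz i))
      ⟨i, Finset.mem_univ i, mul_pos (hB i j) hi⟩).ne' hre
  have hcap := mul_factorial_div_pow_le_norm_coeff n p hhom hstable 1 fun x hx => ?_
  · have hperm : coeff (Finsupp.equivFunOnFinite.symm fun _ => 1) p = (B.permanent : ℂ) := by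
      rw [hp]
      refine (coeff_prod_sum_C_mul_X (B.map fun r => (r : ℂ))).trans ?_
      simp [permanent]
    have hperm0 : 0 ≤ B.permanent :=
      Finset.sum_nonneg fun σ _ => Finset.prod_nonneg fun j _ => (hB _ _).le
    rwa [hperm, Complex.norm_real, Real.norm_of_nonneg hperm0, one_mul] at hcap
  · have : eval (fun i => (x i : ℂ)) p = ((∏ j, ∑ i, B i j * x i : ℝ) : ℂ) := by
      rw [heval]; push_cast; rfl
    rw [this, Complex.norm_real, Real.norm_of_nonneg (Finset.prod_nonneg fun j _ =>
      Finset.sum_nonneg fun i _ => mul_nonneg (hB i j).le (hx i).le), one_mul]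
    calc ∏ i, x i = ∏ j, ∏ i, x i ^ A i j := by
          rw [Finset.prod_comm]
          refine Finset.prod_congr rfl fun i _ => ?_
          rw [← Real.rpow_sum_of_pos (hx i), hrow, Real.rpow_one]
      _ ≤ ∏ j, ∑ i, B i j * x i := by
          refine Finset.prod_le_prod
            (fun j _ => Finset.prod_nonneg fun i _ => Real.rpow_nonneg (hx i).le _) fun j _ => ?_
          refine (Real.geom_mean_le_arith_mean_weighted Finset.univ (fun i => A i j) x
            (fun i _ => hA0 i j) (hcol j) fun i _ => (hx i).le).trans ?_
          exact Finset.sum_le_sum fun i _ => mul_le_mul_of_nonneg_right (hAB i j) (hx i).le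

/-- The van der Waerden bound: a doubly stochastic matrix has permanent at least `n! / n ^ n`. -/
theorem factorial_div_pow_le_permanent {A : Matrix (Fin n) (Fin n) ℝ}
    (hA : A ∈ doublyStochastic ℝ (Fin n)) : n.factorial / (n : ℝ) ^ n ≤ A.permanent := by
  have hcont : Continuous fun ε : ℝ => (of fun i j => A i j + ε : Matrix _ _ ℝ).permanent := by
    simp only [permanent, of_apply]
    fun_prop
  have hlim := (hcont.tendsto 0).mono_left (nhdsWithin_le_nhds (s := Set.Ioi 0))
  have hzero : (of fun i j => A i j + 0 : Matrix _ _ ℝ) = A := by ext; simp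
  rw [hzero] at hlim
  refine ge_of_tendsto hlim ?_
  filter_upwards [self_mem_nhdsWithin] with ε (hε : 0 < ε)
  refine factorial_div_pow_le_permanent_of_pos hA (fun i j => ?_) fun i j => ?_
  · simpa using hε.le
  · exact add_pos_of_nonneg_of_pos (nonneg_of_mem_doublyStochastic hA) hε

end Matrix

/-- The `k × n` Latin rectangles, given by their rows. -/
def LatinRectangle (k n : ℕ) : Type :=
  {L : Fin k → Equiv.Perm (Fin n) // ∀ j, Function.Injective fun i => L i j}

namespace LatinRectangle

variable {k n : ℕ}

instance : Finite (LatinRectangle k n) := Subtype.finite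

/-- The rows by which a Latin rectangle can be extended. -/
abbrev Extension (L : LatinRectangle k n) : Type :=
  {σ : Equiv.Perm (Fin n) // ∀ j i, L.1 i j ≠ σ j}

theorem sum_not_mem_range {g : Fin k → Fin n} (hg : Function.Injective g) :
    (∑ s, if ∀ i, g i ≠ s then 1 else 0 : ℝ) = n - k := by
  have h : (Finset.univ.filter fun s => ∀ i, g i ≠ s) = (Finset.univ.map ⟨g, hg⟩)ᶜ := by
    ext s; simp
  have hkn : k ≤ n := by simpa using Fintype.card_le_of_injective g hg
  rw [Finset.sum_boole, h, Finset.card_compl, Finset.card_map]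
  simp [hkn]

theorem pow_mul_le_card_extension (hk : k < n) (L : LatinRectangle k n) :
    ((n : ℝ) - k) ^ n * (n.factorial / (n : ℝ) ^ n) ≤ Nat.card L.Extension := by
  have hpos : (0 : ℝ) < n - k := sub_pos.2 (by exact_mod_cast hk)
  set M : Matrix (Fin n) (Fin n) ℝ := Matrix.of fun s j => if ∀ i, L.1 i j ≠ s then 1 else 0
  have hM : ((n : ℝ) - k)⁻¹ • M ∈ doublyStochastic ℝ (Fin n) := by
    rw [mem_doublyStochastic_iff_sum]
    refine ⟨fun s j => ?_, fun s => ?_, fun j => ?_⟩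
    · simp only [M, Matrix.smul_apply, Matrix.of_apply, smul_eq_mul]
      split_ifs <;> simp [hpos.le]
    · have hinj : Function.Injective fun i => (L.1 i).symm s := fun i i' h => by
        refine L.2 ((L.1 i).symm s) ?_
        have h' : (L.1 i).symm s = (L.1 i').symm s := h
        change L.1 i _ = L.1 i' _
        rw [Equiv.apply_symm_apply, h', Equiv.apply_symm_apply]
      have := sum_not_mem_range hinj
      simp only [M, Matrix.smul_apply, Matrix.of_apply, smul_eq_mul, ← Finset.mul_sum]
      simp only [ne_eq, Equiv.symm_apply_eq, eq_comm (a := s)] at this ⊢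
      rw [this, inv_mul_cancel₀ hpos.ne']
    · simp only [M, Matrix.smul_apply, Matrix.of_apply, smul_eq_mul, ← Finset.mul_sum]
      rw [sum_not_mem_range (L.2 j), inv_mul_cancel₀ hpos.ne']
  have hperm : M.permanent = Nat.card L.Extension := by
    simp only [Matrix.permanent, M, Matrix.of_apply]
    rw [Nat.card_eq_fintype_card, Fintype.card_subtype, ← Finset.sum_boole]
    refine Finset.sum_congr rfl fun σ _ => ?_
    rw [Finset.prod_ite_zero]
    simp
  have := Matrix.factorial_div_pow_le_permanent hM
  rw [Matrix.permanent_smul, hperm, Fintype.card_fin, inv_pow,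
    le_inv_mul_iff₀ (by positivity)] at this
  exact this

/-- Add a row to a Latin rectangle. -/
def cons (L : LatinRectangle k n) (σ : L.Extension) : LatinRectangle (k + 1) n :=
  ⟨Fin.cons σ.1 L.1, fun j i i' h => by
    cases i using Fin.cases with
    | zero =>
      cases i' using Fin.cases with
      | zero => rfl
      | succ i' => exact absurd h.symm (σ.2 j i')
    | succ i =>
      cases i' using Fin.cases with
      | zero => exact absurd h (σ.2 j i)
      | succ i' => exact congrArg Fin.succ (L.2 j h)⟩

theorem cons_injective :
    Function.Injective fun x : Σ L : LatinRectangle k n, L.Extension => x.1.cons x.2 := by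
  rintro ⟨⟨L, hL⟩, ⟨σ, hσ⟩⟩ ⟨⟨L', hL'⟩, ⟨σ', hσ'⟩⟩ h
  have h' : (Fin.cons σ L : Fin (k + 1) → Equiv.Perm (Fin n)) = Fin.cons σ' L' :=
    congrArg Subtype.val h
  obtain ⟨rfl, rfl⟩ := Fin.cons_injective2 h'
  rfl

theorem prod_le_card (hk : k ≤ n) :
    ∏ i ∈ Finset.range k, (((n : ℝ) - i) ^ n * (n.factorial / (n : ℝ) ^ n)) ≤
      Nat.card (LatinRectangle k n) := by
  induction k with
  | zero =>
    have : Nonempty (LatinRectangle 0 n) := ⟨⟨Fin.elim0, fun _ i => i.elim0⟩⟩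
    simpa using Nat.succ_le_of_lt (Nat.card_pos (α := LatinRectangle 0 n))
  | succ k ih =>
    have := Fintype.ofFinite (LatinRectangle k n)
    set c := ((n : ℝ) - k) ^ n * (n.factorial / (n : ℝ) ^ n)
    have hc : 0 ≤ c := by
      have : (0 : ℝ) ≤ n - k := sub_nonneg.2 (by exact_mod_cast (by omega : k ≤ n))
      positivity
    rw [Finset.prod_range_succ]
    calc _ ≤ (Nat.card (LatinRectangle k n) : ℝ) * c :=
          mul_le_mul_of_nonneg_right (ih (by omega)) hc
      _ = ∑ _L : LatinRectangle k n, c := by simp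
      _ ≤ ∑ L : LatinRectangle k n, (Nat.card L.Extension : ℝ) :=
          Finset.sum_le_sum fun L _ => pow_mul_le_card_extension (by omega) L
      _ = (Nat.card (Σ L : LatinRectangle k n, L.Extension) : ℝ) := by
          rw [Nat.card_sigma]; push_cast; rfl
      _ ≤ _ := by exact_mod_cast Nat.card_le_card_of_injective _ cons_injective

theorem factorial_pow_div_pow_le_card (n : ℕ) :
    (n.factorial : ℝ) ^ (2 * n) / (n : ℝ) ^ (n ^ 2) ≤ Nat.card (LatinRectangle n n) := by
  refine le_of_eq_of_le ?_ (prod_le_card le_rfl)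
  have h : ∏ i ∈ Finset.range n, ((n : ℝ) - i) = n.factorial := by
    rw [← Nat.descFactorial_self, Nat.descFactorial_eq_prod_range, Nat.cast_prod]
    exact Finset.prod_congr rfl fun i hi => (Nat.cast_sub (Finset.mem_range.1 hi).le).symm
  rw [Finset.prod_mul_distrib, Finset.prod_pow, h, Finset.prod_const, Finset.card_range, div_pow,
    ← pow_mul, two_mul, pow_add, sq, mul_div_assoc]

theorem card_le_card_isLatin (n : ℕ) :
    Nat.card (LatinRectangle n n) ≤ Nat.card {L : Fin n → Fin n → Fin n // IsLatin n L} :=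
  Nat.card_le_card_of_injective
    (fun L => ⟨fun i j => L.1 i j, fun i => (L.1 i).bijective,
      fun j => Finite.injective_iff_bijective.1 (L.2 j)⟩)
    fun _ _ h => Subtype.ext <| funext fun i => Equiv.ext fun j =>
      congrFun (congrFun (congrArg Subtype.val h) i) j

end LatinRectangle

theorem Function.Bijective.sum_ite_eq_one {n : ℕ} {f : Fin n → Fin n} (hf : f.Bijective)
    (k : Fin n) : (∑ j, if f j = k then 1 else 0) = 1 := by
  obtain ⟨j, rfl⟩ := hf.2 k
  simp [hf.1.eq_iff]

theorem existsUnique_eq_one_of_sum_eq_one {ι : Type*} [Fintype ι] {f : ι → ℕ}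
    (h : ∑ i, f i = 1) : ∃ i, f i = 1 ∧ ∀ j, f j ≠ 0 → j = i := by
  classical
  obtain ⟨i, -, hi⟩ := Finset.exists_ne_zero_of_sum_ne_zero (h.trans_ne one_ne_zero)
  rw [← Finset.add_sum_erase _ _ (Finset.mem_univ i)] at h
  refine ⟨i, by omega, fun j hj => ?_⟩
  by_contra hji
  have := Finset.single_le_sum (f := f) (fun _ _ => Nat.zero_le _)
    (Finset.mem_erase.2 ⟨hji, Finset.mem_univ j⟩)
  omega

theorem IsLatin.isStochCube {n : ℕ} {L : Fin n → Fin n → Fin n} (h : IsLatin n L) :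
    IsStochCube n fun i j k => if L i j = k then 1 else 0 :=
  ⟨fun i j => by simp, fun i k => (h.1 i).sum_ite_eq_one k, fun j k => (h.2 j).sum_ite_eq_one k⟩

theorem IsStochCube.exists_isLatin {n : ℕ} {A : Fin n → Fin n → Fin n → ℕ}
    (h : IsStochCube n A) :
    ∃ L, IsLatin n L ∧ (fun i j k => if L i j = k then 1 else 0) = A := by
  choose L hL hL' using fun i j => existsUnique_eq_one_of_sum_eq_one (h.1 i j)
  refine ⟨L, ⟨fun i => Finite.surjective_iff_bijective.1 fun k => ?_,
    fun j => Finite.surjective_iff_bijective.1 fun k => ?_⟩, ?_⟩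
  · obtain ⟨j, hj, -⟩ := existsUnique_eq_one_of_sum_eq_one (h.2.1 i k)
    exact ⟨j, (hL' i j k (by simp [hj])).symm⟩
  · obtain ⟨i, hi, -⟩ := existsUnique_eq_one_of_sum_eq_one (h.2.2 j k)
    exact ⟨i, (hL' i j k (by simp [hi])).symm⟩
  · funext i j k
    split_ifs with hk
    · rw [← hk, hL]
    · by_contra hne
      exact hk (hL' i j k (Ne.symm hne)).symm

theorem card_isLatin_eq_card_isStochCube (n : ℕ) :
    Nat.card {L : Fin n → Fin n → Fin n // IsLatin n L} =
      Nat.card {A : Fin n → Fin n → Fin n → ℕ // IsStochCube n A} := by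
  refine Nat.card_eq_of_bijective (fun L => ⟨_, L.2.isStochCube⟩) ⟨fun L L' h => ?_, fun A => ?_⟩
  · refine Subtype.ext <| funext fun i => funext fun j => ?_
    have := congrFun (congrFun (congrFun (congrArg Subtype.val h) i) j) (L.1 i j)
    by_contra hne
    simp [Ne.symm hne] at this
  · obtain ⟨L, hL, hA⟩ := A.2.exists_isLatin
    exact ⟨⟨L, hL⟩, Subtype.ext hA⟩

/-- The integral stochastic semi-magic cubes are equinumerous with Latin squares;
in particular their number (which bounds below the number of vertices of the
polytope of stochastic semi-magic cubes) is at least `(n!)^{2n}/n^{n²}`. -/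
theorem stoch_cube_latin (n : ℕ) :
    Nat.card {A : Fin n → Fin n → Fin n → ℕ // IsStochCube n A} =
      Nat.card {L : Fin n → Fin n → Fin n // IsLatin n L} ∧
    ((n.factorial : ℚ)) ^ (2 * n) / (n : ℚ) ^ (n ^ 2) ≤
      (Nat.card {A : Fin n → Fin n → Fin n → ℕ // IsStochCube n A} : ℚ) := by
  refine ⟨(card_isLatin_eq_card_isStochCube n).symm, ?_⟩
  have h := (LatinRectangle.factorial_pow_div_pow_le_card n).trans
    (Nat.cast_le.2 (LatinRectangle.card_le_card_isLatin n))
  rw [card_isLatin_eq_card_isStochCube] at h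
  rw [← Rat.cast_le (K := ℝ)]
  push_cast
  exact h
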